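/- arXiv:1904.05989 — 10 statements merged into one kernel-verified Lean document; each statement's English description precedes it below -/
import Mathlib

section
/- Let M ≥ 1, let τ₁ < τ₂ < ⋯ < τ_M be real numbers, let α₁, …, α_M be real numbers, and let θ₊, θ₋ ∈ (0, 1]. Set θ̄ = (θ₊+θ₋)/2, Δθ = (θ₊−θ₋)/2, and assume Σ_{j=1}^{M} (α_j − 1) = θ̄. Then there exists a constant K such that for all real t, |∫₀^t e^{Δθ·τ} ∏_{j=1}^{M} cosh(τ−τ_j)^{α_j−1} dτ − (1/(θ₊·θ₋·2^{θ̄−1}))·(1/2)·(θ₋·e^{θ₊ t − S} − θ₊·e^{−θ₋ t + S})| ≤ K, where S = Σ_{j=1}^{M} (α_j − 1)·τ_j; that is, the integral equals the displayed expression plus O(1) as |t| → ∞ along the reals. -/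
open Real

/-- A function whose derivative decays exponentially on `[0, ∞)` is bounded there. -/
lemma exists_bound_of_abs_deriv_le_exp {H h : ℝ → ℝ} {C a : ℝ} (ha : 0 < a)
    (hH : ∀ x, HasDerivAt H (h x) x) (hh : ∀ x, 0 ≤ x → |h x| ≤ C * exp (-a * x)) :
    ∃ K, ∀ t, 0 ≤ t → |H t| ≤ K := by
  have hC : 0 ≤ C := by simpa using (abs_nonneg _).trans (hh 0 le_rfl)
  refine ⟨|H 0| + C / a, fun t ht => ?_⟩
  have hB : ∀ x, HasDerivAt (fun x => |H 0| + C / a * (1 - exp (-a * x)))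
      (C * exp (-a * x)) x := by
    intro x
    have h1 : HasDerivAt (fun x => exp (-a * x)) (exp (-a * x) * (-a * 1)) x :=
      ((hasDerivAt_id x).const_mul (-a)).exp
    refine (((h1.const_sub 1).const_mul (C / a)).const_add |H 0|).congr_deriv ?_
    field_simp
  have key := image_norm_le_of_norm_deriv_right_le_deriv_boundary (a := 0) (b := t)
    (fun x _ => (hH x).continuousAt.continuousWithinAt)
    (fun x _ => (hH x).hasDerivWithinAt) (by simp) hB
    (fun x hx => hh x hx.1) (Set.right_mem_Icc.2 ht)
  refine (norm_eq_abs (H t) ▸ key).trans ?_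
  have : C / a * (1 - exp (-a * t)) ≤ C / a * 1 := by
    gcongr
    linarith [exp_pos (-a * t)]
  linarith

lemma cosh_sub_rpow (x s b : ℝ) :
    cosh (x - s) ^ b =
      (2 : ℝ) ^ (-b) * exp (b * x - b * s) * (1 + exp (2 * s) * exp (-2 * x)) ^ b := by
  have h : cosh (x - s) = 2⁻¹ * exp (x - s) * (1 + exp (2 * s) * exp (-2 * x)) := by
    rw [cosh_eq, mul_add, ← exp_add, mul_assoc _ (exp _) (exp _), ← exp_add,
      show x - s + (2 * s + -2 * x) = -(x - s) by ring]
    ring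
  rw [h, mul_rpow (by positivity) (by positivity), mul_rpow (by positivity) (by positivity),
    ← exp_mul, inv_rpow zero_le_two, ← rpow_neg zero_le_two]
  congr 3
  ring

lemma prod_cosh_sub_rpow {ι : Type*} [Fintype ι] (s b : ι → ℝ) (x : ℝ) :
    ∏ j, cosh (x - s j) ^ b j =
      (2 : ℝ) ^ (-∑ j, b j) * exp ((∑ j, b j) * x - ∑ j, b j * s j) *
        ∏ j, (1 + exp (2 * s j) * exp (-2 * x)) ^ b j := by
  simp_rw [cosh_sub_rpow, Finset.prod_mul_distrib]
  rw [← exp_sum, Finset.sum_sub_distrib, ← Finset.sum_mul, ← Finset.sum_neg_distrib,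
    rpow_sum_of_pos zero_lt_two]

lemma exists_abs_prod_one_add_mul_rpow_sub_one_le {ι : Type*} [Fintype ι] (c b : ι → ℝ)
    (hc : ∀ j, 0 ≤ c j) :
    ∃ C, ∀ u ∈ Set.Icc (0 : ℝ) 1, |∏ j, (1 + c j * u) ^ b j - 1| ≤ C * u := by
  set P : ℝ → ℝ := fun u => ∏ j, (1 + c j * u) ^ b j with hP
  have hdiff : ∀ u, 0 ≤ u → DifferentiableAt ℝ P u := by
    intro u hu
    refine DifferentiableAt.fun_finsetProd fun j _ => ?_
    have : 1 + c j * u ≠ 0 := by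
      have := mul_nonneg (hc j) hu
      positivity
    exact DifferentiableAt.rpow_const (by fun_prop) (Or.inl this)
  have hcont : ContinuousOn (dslope P 0) (Set.Icc 0 1) := by
    intro u hu
    refine ContinuousAt.continuousWithinAt ?_
    rcases eq_or_ne u 0 with rfl | hne
    · exact continuousAt_dslope_same.2 (hdiff 0 le_rfl)
    · exact (continuousAt_dslope_of_ne hne).2 (hdiff u hu.1).continuousAt
  obtain ⟨C, hC⟩ := isCompact_Icc.exists_bound_of_continuousOn hcont
  refine ⟨C, fun u hu => ?_⟩
  have h0 : P 0 = 1 := by simp [hP]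
  have h1 := sub_smul_dslope P 0 u
  rw [h0, sub_zero, smul_eq_mul] at h1
  change |P u - 1| ≤ C * u
  rw [← h1, abs_mul, abs_of_nonneg hu.1, mul_comm]
  exact mul_le_mul_of_nonneg_right (hC u hu) hu.1

lemma continuous_exp_mul_prod_cosh_rpow {ι : Type*} [Fintype ι] (s b : ι → ℝ) (d : ℝ) :
    Continuous fun x => exp (d * x) * ∏ j, cosh (x - s j) ^ b j := by
  refine Continuous.mul (by fun_prop) (continuous_finsetProd _ fun j _ => ?_)
  exact Continuous.rpow_const (by fun_prop) fun x => Or.inl (ne_of_gt (cosh_pos _))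

/-- The expansion as `t → +∞`. -/
lemma exists_bound_integral_exp_mul_prod_cosh_of_nonneg {ι : Type*} [Fintype ι] (s b : ι → ℝ)
    {p m : ℝ} (hp : p ∈ Set.Ioc (0 : ℝ) 1) (hm : m ∈ Set.Ioc (0 : ℝ) 1)
    (hsum : ∑ j, b j = (p + m) / 2) :
    ∃ K : ℝ, ∀ t : ℝ, 0 ≤ t →
      |(∫ x in (0:ℝ)..t, exp ((p - m) / 2 * x) * ∏ j, cosh (x - s j) ^ b j) -
        (1 / (p * m * (2 : ℝ) ^ ((p + m) / 2 - 1))) * (1 / 2) *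
          (m * exp (p * t - ∑ j, b j * s j) - p * exp (-m * t + ∑ j, b j * s j))| ≤ K := by
  obtain ⟨hp0, hp1⟩ := hp
  obtain ⟨hm0, hm1⟩ := hm
  set S := ∑ j, b j * s j with hS
  set k : ℝ := (2 : ℝ) ^ (-((p + m) / 2)) with hk
  have hk0 : 0 < k := by positivity
  obtain ⟨C, hC⟩ := exists_abs_prod_one_add_mul_rpow_sub_one_le (fun j => exp (2 * s j)) b
    fun j => (exp_pos _).le
  have hC0 : 0 ≤ C := by simpa using (abs_nonneg _).trans (hC 1 ⟨zero_le_one, le_rfl⟩)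
  have hcoef : (1 / (p * m * (2 : ℝ) ^ ((p + m) / 2 - 1))) * (1 / 2) = k / (p * m) := by
    rw [hk, rpow_sub_one two_ne_zero, rpow_neg zero_le_two]
    field_simp
  rw [hcoef]
  refine exists_bound_of_abs_deriv_le_exp
    (h := fun x => exp ((p - m) / 2 * x) * ∏ j, cosh (x - s j) ^ b j -
      k * (exp (p * x - S) + exp (-m * x + S)))
    (C := k * (exp (-S) * C + exp S)) hm0 (fun x => ?_) (fun x hx => ?_)
  · have h1 := (continuous_exp_mul_prod_cosh_rpow s b ((p - m) / 2)).integral_hasStrictDerivAt 0 x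
    have h2 : HasDerivAt (fun x => exp (p * x - S)) (exp (p * x - S) * (p * 1)) x :=
      (((hasDerivAt_id x).const_mul p).sub_const S).exp
    have h3 : HasDerivAt (fun x => exp (-m * x + S)) (exp (-m * x + S) * (-m * 1)) x :=
      (((hasDerivAt_id x).const_mul (-m)).add_const S).exp
    refine (h1.hasDerivAt.sub
      (((h2.const_mul m).sub (h3.const_mul p)).const_mul (k / (p * m)))).congr_deriv ?_
    field_simp
    ring
  · have hu : exp (-2 * x) ∈ Set.Icc (0 : ℝ) 1 :=
      ⟨(exp_pos _).le, exp_le_one_iff.2 (by linarith)⟩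
    have hPu := hC _ hu
    rw [prod_cosh_sub_rpow, hsum, ← hS, ← hk]
    set P := ∏ j, (1 + exp (2 * s j) * exp (-2 * x)) ^ b j
    have e1 : exp ((p - m) / 2 * x) * (k * exp ((p + m) / 2 * x - S) * P) -
        k * (exp (p * x - S) + exp (-m * x + S)) =
        k * (exp (p * x - S) * (P - 1) - exp (-m * x + S)) := by
      rw [show p * x - S = (p - m) / 2 * x + ((p + m) / 2 * x - S) by ring,
        exp_add ((p - m) / 2 * x)]
      ring
    have e2 : exp (p * x - S) * exp (-2 * x) ≤ exp (-S) * exp (-m * x) := by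
      rw [← exp_add, ← exp_add, exp_le_exp]
      nlinarith
    rw [e1, abs_mul, abs_of_pos hk0, mul_assoc]
    refine mul_le_mul_of_nonneg_left ?_ hk0.le
    calc |exp (p * x - S) * (P - 1) - exp (-m * x + S)|
        ≤ |exp (p * x - S) * (P - 1)| + |exp (-m * x + S)| := abs_sub _ _
      _ = exp (p * x - S) * |P - 1| + exp S * exp (-m * x) := by
          rw [abs_mul, abs_exp, abs_exp, exp_add, mul_comm (exp S)]
      _ ≤ exp (p * x - S) * (C * exp (-2 * x)) + exp S * exp (-m * x) := by gcongr
      _ = C * (exp (p * x - S) * exp (-2 * x)) + exp S * exp (-m * x) := by ring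
      _ ≤ C * (exp (-S) * exp (-m * x)) + exp S * exp (-m * x) := by gcongr
      _ = (exp (-S) * C + exp S) * exp (-m * x) := by ring

theorem asymptotic_expansion_SC_integral
    (M : ℕ) (hM : 1 ≤ M) (τ α : Fin M → ℝ)
    (hτ : StrictMono τ)
    (θp θm : ℝ) (hθp : θp ∈ Set.Ioc (0 : ℝ) 1) (hθm : θm ∈ Set.Ioc (0 : ℝ) 1)
    (hsum : ∑ j, (α j - 1) = (θp + θm) / 2) :
    ∃ K : ℝ, ∀ t : ℝ,
      |(∫ x in (0:ℝ)..t,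
          Real.exp ((θp - θm) / 2 * x) * ∏ j, Real.cosh (x - τ j) ^ (α j - 1)) -
        (1 / (θp * θm * (2 : ℝ) ^ ((θp + θm) / 2 - 1))) * (1 / 2) *
          (θm * Real.exp (θp * t - ∑ j, (α j - 1) * τ j) -
            θp * Real.exp (-θm * t + ∑ j, (α j - 1) * τ j))| ≤ K := by
  obtain ⟨K₁, hK₁⟩ := exists_bound_integral_exp_mul_prod_cosh_of_nonneg τ (fun j => α j - 1)
    hθp hθm hsum
  obtain ⟨K₂, hK₂⟩ := exists_bound_integral_exp_mul_prod_cosh_of_nonneg (fun j => -τ j)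
    (fun j => α j - 1) hθm hθp (by rw [hsum, add_comm])
  refine ⟨max K₁ K₂, fun t => ?_⟩
  rcases le_total 0 t with ht | ht
  · exact (hK₁ t ht).trans (le_max_left _ _)
  · refine le_trans (le_of_eq ?_) ((hK₂ (-t) (by linarith)).trans (le_max_right _ _))
    have hint : (∫ x in (0:ℝ)..-t,
        exp ((θm - θp) / 2 * x) * ∏ j, cosh (x - -τ j) ^ (α j - 1)) =
        -∫ x in (0:ℝ)..t, exp ((θp - θm) / 2 * x) * ∏ j, cosh (x - τ j) ^ (α j - 1) := by
      rw [← intervalIntegral.integral_symm, ← neg_zero, ← intervalIntegral.integral_comp_neg,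
        neg_zero]
      refine intervalIntegral.integral_congr fun x _ => ?_
      have hcosh : ∀ j, cosh (-x - -τ j) = cosh (x - τ j) := fun j => by
        rw [← cosh_neg]
        congr 1
        ring
      simp only [hcosh]
      congr 2
      ring
    rw [hint, ← abs_neg]
    simp only [mul_neg, Finset.sum_neg_distrib, sub_neg_eq_add, neg_mul, neg_neg,
      add_comm θm θp, mul_comm θm θp, ← sub_eq_add_neg]
    congr 1
    ring
end

section
/- Let m ≥ 1, let a₁, …, a_m be real numbers, let b₁, …, b_{m−1} be pairwise distinct real numbers, and set T = a₁ − b₁ + a₂ − ⋯ − b_{m−1} + a_m (i.e., T = Σ_j a_j − Σ_j b_j). Then there exist real numbers L₁, …, L_{m−1} such that for every z ∈ ℂ with cosh(z − b_j) ≠ 0 for all j = 1, …, m−1, one has (∏_{j=1}^{m} cosh(z − a_j)) / (∏_{j=1}^{m−1} cosh(z − b_j)) = cosh(z − T) + Σ_{j=1}^{m−1} L_j / (e^{z−b_j} + e^{−z+b_j}). -/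
/-- The hyperbolic three-term relation expressing `cosh (z - a)` through `cosh (z - b)` and
`cosh (z - c)`. -/
lemma Complex.sinh_sub_mul_cosh_sub (z a b c : ℂ) :
    sinh (b - c) * cosh (z - a) = sinh (a - c) * cosh (z - b) + sinh (b - a) * cosh (z - c) := by
  simp only [sinh_sub, cosh_sub]
  ring

lemma Complex.cosh_sub_mul_cosh_sub (z t a b : ℂ) :
    cosh (z - t) * cosh (z - a) =
      cosh (z - (a - b + t)) * cosh (z - b) - sinh (t - b) * sinh (a - b) := by
  obtain ⟨u, rfl⟩ : ∃ u, z = u + b := ⟨z - b, by ring⟩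
  obtain ⟨x, rfl⟩ : ∃ x, t = x + b := ⟨t - b, by ring⟩
  obtain ⟨y, rfl⟩ : ∃ y, a = y + b := ⟨a - b, by ring⟩
  rw [show u + b - (x + b) = u - x by ring, show u + b - (y + b) = u - y by ring,
    show u + b - (y + b - b + (x + b)) = u - (x + y) by ring, add_sub_cancel_right,
    add_sub_cancel_right, add_sub_cancel_right]
  simp only [cosh_sub, cosh_add, sinh_add]
  linear_combination -(sinh x * sinh y) * cosh_sq_sub_sinh_sq u

/-- The decomposition with the denominators `cosh (z - b j)`. -/
lemma exists_prod_cosh_div_prod_cosh_eq (n : ℕ) (a : Fin (n + 1) → ℝ) (b : Fin n → ℝ)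
    (hb : Function.Injective b) :
    ∃ L : Fin n → ℝ, ∀ z : ℂ, (∀ j, Complex.cosh (z - (b j : ℂ)) ≠ 0) →
      (∏ j, Complex.cosh (z - (a j : ℂ))) / (∏ j, Complex.cosh (z - (b j : ℂ))) =
        Complex.cosh (z - ((∑ j, a j - ∑ j, b j : ℝ) : ℂ)) +
          ∑ j, (L j : ℂ) / Complex.cosh (z - (b j : ℂ)) := by
  induction n with
  | zero => exact ⟨0, fun z _ => by simp⟩
  | succ n ih =>
    obtain ⟨L, hL⟩ := ih (fun j => a j.succ) (fun j => b j.succ)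
      (hb.comp (Fin.succ_injective n))
    set t : ℝ := ∑ j : Fin (n + 1), a j.succ - ∑ j : Fin n, b j.succ with ht
    refine ⟨Fin.cons
      (-(Real.sinh (t - b 0) * Real.sinh (a 0 - b 0)) +
        ∑ j, L j * (Real.sinh (b 0 - a 0) / Real.sinh (b 0 - b j.succ)))
      (fun j => L j * (Real.sinh (a 0 - b j.succ) / Real.sinh (b 0 - b j.succ))),
      fun z hz => ?_⟩
    have h0 := hz 0
    have hsum : ∑ j, a j - ∑ j, b j = a 0 - b 0 + t := by
      rw [Fin.sum_univ_succ a, Fin.sum_univ_succ b, ht]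
      ring
    have hterm (j : Fin n) :
        (L j : ℂ) / Complex.cosh (z - b j.succ) *
            (Complex.cosh (z - a 0) / Complex.cosh (z - b 0)) =
          (L j * (Real.sinh (b 0 - a 0) / Real.sinh (b 0 - b j.succ)) : ℝ) /
              Complex.cosh (z - b 0) +
            (L j * (Real.sinh (a 0 - b j.succ) / Real.sinh (b 0 - b j.succ)) : ℝ) /
              Complex.cosh (z - b j.succ) := by
      have hj := hz j.succ
      have hs : Complex.sinh ((b 0 : ℂ) - b j.succ) ≠ 0 := by
        rw [← Complex.ofReal_sub, ← Complex.ofReal_sinh, Complex.ofReal_ne_zero, Ne,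
          Real.sinh_eq_zero, sub_eq_zero]
        exact fun h => Fin.succ_ne_zero j (hb h).symm
      push_cast
      field_simp
      linear_combination (L j : ℂ) * Complex.sinh_sub_mul_cosh_sub z (a 0) (b 0) (b j.succ)
    have hlead : Complex.cosh (z - t) * (Complex.cosh (z - a 0) / Complex.cosh (z - b 0)) =
        Complex.cosh (z - (a 0 - b 0 + t : ℝ)) +
          (-(Real.sinh (t - b 0) * Real.sinh (a 0 - b 0)) : ℝ) / Complex.cosh (z - b 0) := by
      push_cast
      field_simp
      linear_combination Complex.cosh_sub_mul_cosh_sub z t (a 0) (b 0)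
    rw [hsum, Fin.prod_univ_succ, Fin.prod_univ_succ fun j => Complex.cosh (z - b j),
      Fin.sum_univ_succ (n := n), mul_div_mul_comm, hL z fun j => hz j.succ, mul_comm, add_mul, hlead,
      Finset.sum_mul, Finset.sum_congr rfl fun j _ => hterm j, Finset.sum_add_distrib,
      ← Finset.sum_div]
    simp only [Fin.cons_zero, Fin.cons_succ, Complex.ofReal_add, Complex.ofReal_sum]
    ring

/-- Partial-fraction type decomposition of the Schwarz–Christoffel integrand with
`n + 1` points `a` and `n` points `b` (i.e. `m = n + 1 ≥ 1` in the paper's notation). -/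
theorem cosh_quotient_decomposition
    (n : ℕ) (a : Fin (n + 1) → ℝ) (b : Fin n → ℝ)
    (hb : Function.Injective b) :
    ∃ L : Fin n → ℝ, ∀ z : ℂ, (∀ j, Complex.cosh (z - (b j : ℂ)) ≠ 0) →
      (∏ j, Complex.cosh (z - (a j : ℂ))) / (∏ j, Complex.cosh (z - (b j : ℂ))) =
        Complex.cosh (z - ((∑ j, a j - ∑ j, b j : ℝ) : ℂ)) +
          ∑ j, (L j : ℂ) /
            (Complex.exp (z - (b j : ℂ)) + Complex.exp (-z + (b j : ℂ))) := by
  obtain ⟨L, hL⟩ := exists_prod_cosh_div_prod_cosh_eq n a b hb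
  refine ⟨fun j => 2 * L j, fun z hz => ?_⟩
  rw [hL z hz]
  congr 1
  refine Finset.sum_congr rfl fun j _ => ?_
  rw [show -z + (b j : ℂ) = -(z - b j) by ring, ← Complex.two_cosh, Complex.ofReal_mul,
    Complex.ofReal_ofNat, mul_div_mul_left _ _ two_ne_zero]
end

section
/- Let m ≥ 2 and suppose real numbers a₁, …, a_m, b₁, …, b_{m−1}, D₁, …, D_{m−1}, C and T satisfy the interleaving condition a₁ < b₁ < a₂ < b₂ < ⋯ < b_{m−1} < a_m, the nondegeneracy condition (C, D₁, …, D_{m−1}) ≠ (0, 0, …, 0), and the system of m equations C·sinh(a_k − T) − Σ_{j=1}^{m−1} D_j / sinh(a_k − b_j) = 0 for k = 1, …, m. Then a₁ − b₁ + a₂ − ⋯ − b_{m−1} + a_m = T. -/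
open Polynomial in
/-- A nontrivial relation `c (x - t) = ∑ j, d j * x / (x - y j)` of degree `n + 1` in `x`, holding at
`n + 1` distinct points, determines the product of these points. -/
theorem prod_eq_of_partial_fraction_relation {K : Type*} [Field K] {n : ℕ}
    {x : Fin (n + 1) → K} {y d : Fin n → K} {c t : K}
    (hx : Function.Injective x) (hy : Function.Injective y) (hy0 : ∀ j, y j ≠ 0)
    (hxy : ∀ k j, x k ≠ y j) (hne : ¬ (c = 0 ∧ ∀ j, d j = 0))
    (h : ∀ k, c * (x k - t) = ∑ j, d j * x k / (x k - y j)) :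
    ∏ k, x k = t * ∏ j, y j := by
  classical
  set R : K[X] := X * ∑ j, C (d j) * ∏ i ∈ Finset.univ.erase j, (X - C (y i)) with hR
  set M : K[X] := (X - C t) * ∏ j, (X - C (y j)) with hM
  set N : K[X] := ∏ k, (X - C (x k)) with hN
  have hC (r : K) (p : K[X]) : (C r * p).degree ≤ p.degree := by
    rw [← smul_eq_C_mul]
    exact degree_smul_le r p
  have hMmonic : M.Monic := (monic_X_sub_C t).mul (monic_prod_X_sub_C y _)
  have hNmonic : N.Monic := monic_prod_X_sub_C x _
  have hMdeg : M.degree = (n + 1 : ℕ) := by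
    rw [hM, degree_mul, degree_prod]
    simp [add_comm]
  have hNdeg : N.degree = (n + 1 : ℕ) := by
    rw [hN, degree_prod]
    simp
  have hsub : (M - N).degree < (n + 1 : ℕ) := by
    rw [← hMdeg]
    exact degree_sub_lt_left (hMdeg.trans hNdeg.symm) hMmonic.ne_zero
      (hMmonic.leadingCoeff.trans hNmonic.leadingCoeff.symm)
  have hRdeg : R.degree < (n + 1 : ℕ) := by
    have hS : (∑ j, C (d j) * ∏ i ∈ Finset.univ.erase j, (X - C (y i))).degree < (n : ℕ) := by
      refine (degree_sum_le _ _).trans_lt ((Finset.sup_lt_iff (WithBot.bot_lt_coe n)).2 ?_)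
      intro j _
      refine (hC _ _).trans_lt ?_
      rw [degree_prod]
      simp only [degree_X_sub_C, Finset.sum_const, Finset.card_erase_of_mem (Finset.mem_univ j),
        Finset.card_univ, Fintype.card_fin, nsmul_eq_mul, mul_one]
      exact WithBot.coe_lt_coe.2 (Nat.sub_lt j.pos one_pos)
    by_cases h0 : (∑ j, C (d j) * ∏ i ∈ Finset.univ.erase j, (X - C (y i))) = 0
    · rw [hR, h0, mul_zero, degree_zero]
      exact WithBot.bot_lt_coe _
    · rw [hR, degree_mul, degree_X, degree_eq_natDegree h0]
      have : natDegree (∑ j, C (d j) * ∏ i ∈ Finset.univ.erase j, (X - C (y i))) < n := by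
        exact (natDegree_lt_iff_degree_lt h0).2 hS
      norm_cast
      omega
  have hzero : C c * (M - N) - R = 0 := by
    refine eq_zero_of_degree_lt_of_eval_index_eq_zero (s := Finset.univ) (v := x) hx.injOn ?_ ?_
    · rw [Finset.card_univ, Fintype.card_fin]
      exact (degree_sub_le _ _).trans_lt (max_lt ((hC _ _).trans_lt hsub) hRdeg)
    · intro k _
      have hNk : N.eval (x k) = 0 := by
        rw [hN, eval_prod]
        exact Finset.prod_eq_zero (Finset.mem_univ k) (by simp)
      have hMk : c * M.eval (x k) = R.eval (x k) := by
        simp only [hM, hR, eval_mul, eval_sub, eval_X, eval_C, eval_prod, eval_finsetSum]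
        rw [← mul_assoc, h k, Finset.sum_mul, Finset.mul_sum]
        refine Finset.sum_congr rfl fun j _ => ?_
        have := sub_ne_zero.2 (hxy k j)
        rw [← Finset.mul_prod_erase _ _ (Finset.mem_univ j)]
        field_simp
      simp [hNk, hMk]
  have hc : c ≠ 0 := by
    rintro rfl
    refine hne ⟨rfl, fun j => ?_⟩
    have hev : R.eval (y j) = 0 := by
      have : R = 0 := by simpa using hzero
      simp [this]
    simp only [hR, eval_mul, eval_sub, eval_X, eval_C, eval_prod, eval_finsetSum] at hev
    rw [Finset.sum_eq_single j] at hev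
    · have hprod : ∏ i ∈ Finset.univ.erase j, (y j - y i) ≠ 0 :=
        Finset.prod_ne_zero_iff.2 fun i hi =>
          sub_ne_zero.2 (hy.ne (Finset.ne_of_mem_erase hi).symm)
      simpa [hy0 j, hprod] using hev
    · intro i _ hij
      rw [Finset.prod_eq_zero (Finset.mem_erase.2 ⟨hij.symm, Finset.mem_univ j⟩) (sub_self _),
        mul_zero]
    · simp
  have hev := congrArg (eval 0) hzero
  simp only [hM, hN, hR, eval_mul, eval_sub, eval_X, eval_C, eval_prod, eval_zero, zero_mul,
    sub_zero, zero_sub, mul_eq_zero, hc, false_or, Finset.prod_neg, Finset.card_univ,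
    Fintype.card_fin] at hev
  have hsign : ((-1 : K) ^ n) ≠ 0 := pow_ne_zero _ (by simp)
  refine mul_left_cancel₀ hsign ?_
  linear_combination hev

theorem Real.sinh_sub_eq_exp_sq (u v : ℝ) :
    Real.sinh (u - v) =
      (Real.exp u ^ 2 - Real.exp v ^ 2) / (2 * Real.exp u * Real.exp v) := by
  rw [Real.sinh_eq, neg_sub, Real.exp_sub, Real.exp_sub]
  field_simp

theorem strictMono_of_interlacing {α : Type*} [Preorder α] {n : ℕ}
    {a : Fin (n + 1) → α} {b : Fin n → α}
    (hab : ∀ j : Fin n, a j.castSucc < b j ∧ b j < a j.succ) :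
    StrictMono a :=
  Fin.strictMono_iff_lt_succ.2 fun j => (hab j).1.trans (hab j).2

theorem strictMono_inner_of_interlacing {α : Type*} [Preorder α] {n : ℕ}
    {a : Fin (n + 1) → α} {b : Fin n → α}
    (hab : ∀ j : Fin n, a j.castSucc < b j ∧ b j < a j.succ) :
    StrictMono b := fun i j hij =>
  (hab i).2.trans_le (((strictMono_of_interlacing hab).monotone
    (Fin.succ_le_castSucc_iff.2 hij)).trans (hab j).1.le)

theorem ne_of_interlacing {α : Type*} [Preorder α] {n : ℕ}
    {a : Fin (n + 1) → α} {b : Fin n → α}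
    (hab : ∀ j : Fin n, a j.castSucc < b j ∧ b j < a j.succ) (k : Fin (n + 1)) (j : Fin n) :
    a k ≠ b j := by
  have ha := (strictMono_of_interlacing hab).monotone
  rcases le_or_gt k j.castSucc with hk | hk
  · exact ((ha hk).trans_lt (hab j).1).ne
  · exact ((hab j).2.trans_le (ha (Fin.castSucc_lt_iff_succ_le.1 hk))).ne.symm

/-- If the interleaved parameters `a₁ < b₁ < a₂ < ⋯ < b_{m−1} < a_m` (here `m = n + 1 ≥ 2`)
solve the nondegenerate homogeneous system
`C·sinh(a_k − T) − Σ_j D_j / sinh(a_k − b_j) = 0`,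
then `T = a₁ − b₁ + a₂ − ⋯ − b_{m−1} + a_m`. -/
theorem alternating_sum_eq_T
    (n : ℕ) (hn : 1 ≤ n)
    (a : Fin (n + 1) → ℝ) (b : Fin n → ℝ) (D : Fin n → ℝ) (C T : ℝ)
    (hinter : ∀ j : Fin n, a j.castSucc < b j ∧ b j < a j.succ)
    (hnondeg : ¬ (C = 0 ∧ ∀ j, D j = 0))
    (hsys : ∀ k : Fin (n + 1),
      C * Real.sinh (a k - T) - ∑ j, D j / Real.sinh (a k - b j) = 0) :
    ∑ j, a j - ∑ j, b j = T := by
  have hinj : Function.Injective fun u : ℝ => Real.exp u ^ 2 := fun u v huv =>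
    Real.exp_injective
      ((pow_left_inj₀ (Real.exp_pos u).le (Real.exp_pos v).le two_ne_zero).1 huv)
  have key := prod_eq_of_partial_fraction_relation
    (x := fun k => Real.exp (a k) ^ 2) (y := fun j => Real.exp (b j) ^ 2)
    (d := fun j => 2 * D j * Real.exp (b j)) (c := C / (2 * Real.exp T)) (t := Real.exp T ^ 2)
    (hinj.comp (strictMono_of_interlacing hinter).injective)
    (hinj.comp (strictMono_inner_of_interlacing hinter).injective)
    (fun j => by positivity)
    (fun k j => hinj.ne (ne_of_interlacing hinter k j))
    (by simpa using hnondeg)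
    (fun k => by
      have hk := sub_eq_zero.1 (hsys k)
      calc C / (2 * Real.exp T) * (Real.exp (a k) ^ 2 - Real.exp T ^ 2)
          = Real.exp (a k) * (C * Real.sinh (a k - T)) := by
            rw [Real.sinh_sub_eq_exp_sq]
            field_simp
        _ = _ := by
            rw [hk, Finset.mul_sum]
            refine Finset.sum_congr rfl fun j _ => ?_
            have : Real.exp (a k) ^ 2 - Real.exp (b j) ^ 2 ≠ 0 :=
              sub_ne_zero.2 (hinj.ne (ne_of_interlacing hinter k j))
            rw [Real.sinh_sub_eq_exp_sq]
            field_simp)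
  simp only [Finset.prod_pow, ← Real.exp_sum, ← mul_pow, ← Real.exp_add] at key
  linarith [hinj key]
end

section
/- Let a₁, a₂, b₁ be real numbers and set T = a₁ − b₁ + a₂ and K = (1/2)·(cosh(a₁ − a₂) − cosh(a₁ + a₂ − 2b₁)). Then for every real t, ∫₀^t cosh(τ − a₁)·cosh(τ − a₂) / cosh(τ − b₁) dτ = (sinh(t − T) − sinh(−T)) + 2K·(arctan(e^{t−b₁}) − arctan(e^{−b₁})). -/
open Real

lemma cosh_mul_cosh_eq_half_add (x y : ℝ) :
    cosh x * cosh y = (cosh (x + y) + cosh (x - y)) / 2 := by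
  rw [cosh_add, cosh_sub]
  ring

lemma cosh_mul_cosh_div_cosh (x y z : ℝ) :
    cosh x * cosh y / cosh z =
      cosh (x + y - z) + 1 / 2 * (cosh (x - y) - cosh (x + y - 2 * z)) / cosh z := by
  have hz : cosh z ≠ 0 := (cosh_pos z).ne'
  have h := cosh_mul_cosh_eq_half_add (x + y - z) z
  rw [sub_add_cancel, show x + y - z - z = x + y - 2 * z by ring] at h
  rw [← mul_div_cancel_right₀ (cosh (x + y - z)) hz, ← add_div, h, cosh_mul_cosh_eq_half_add x y]
  ring

lemma hasDerivAt_two_mul_arctan_exp (x : ℝ) :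
    HasDerivAt (fun s => 2 * arctan (exp s)) (1 / cosh x) x := by
  refine ((hasDerivAt_exp x).arctan.const_mul 2).congr_deriv ?_
  have hx := exp_pos x
  rw [cosh_eq, exp_neg]
  field_simp
  ring

/-- Explicit closed form of the proposed transformation `H_New` in the case `m = 2`. -/
theorem H_New_closed_form_m2
    (a₁ a₂ b₁ : ℝ) :
    ∀ t : ℝ,
      (∫ τ in (0:ℝ)..t,
          Real.cosh (τ - a₁) * Real.cosh (τ - a₂) / Real.cosh (τ - b₁)) =
        (Real.sinh (t - (a₁ - b₁ + a₂)) - Real.sinh (-(a₁ - b₁ + a₂))) +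
          2 * (1 / 2 * (Real.cosh (a₁ - a₂) - Real.cosh (a₁ + a₂ - 2 * b₁))) *
            (Real.arctan (Real.exp (t - b₁)) - Real.arctan (Real.exp (-b₁))) := by
  intro t
  set K : ℝ := 1 / 2 * (cosh (a₁ - a₂) - cosh (a₁ + a₂ - 2 * b₁)) with hK
  have hderiv : ∀ τ ∈ Set.uIcc 0 t, HasDerivAt
      (fun s => sinh (s - (a₁ - b₁ + a₂)) + K * (2 * arctan (exp (s - b₁))))
      (cosh (τ - a₁) * cosh (τ - a₂) / cosh (τ - b₁)) τ := by
    intro τ _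
    have hsinh := (hasDerivAt_sinh (τ - (a₁ - b₁ + a₂))).comp_sub_const τ (a₁ - b₁ + a₂)
    have harctan := (hasDerivAt_two_mul_arctan_exp (τ - b₁)).comp_sub_const τ b₁
    refine (hsinh.add (harctan.const_mul K)).congr_deriv ?_
    rw [cosh_mul_cosh_div_cosh, hK,
      show τ - a₁ + (τ - a₂) - (τ - b₁) = τ - (a₁ - b₁ + a₂) by ring,
      show τ - a₁ - (τ - a₂) = -(a₁ - a₂) by ring,
      show τ - a₁ + (τ - a₂) - 2 * (τ - b₁) = -(a₁ + a₂ - 2 * b₁) by ring,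
      cosh_neg, cosh_neg]
    ring
  have hcont : Continuous fun τ => cosh (τ - a₁) * cosh (τ - a₂) / cosh (τ - b₁) :=
    Continuous.div (by fun_prop) (by fun_prop) fun τ => (cosh_pos _).ne'
  rw [intervalIntegral.integral_eq_sub_of_hasDerivAt hderiv (hcont.intervalIntegrable 0 t),
    zero_sub, zero_sub]
  ring
end

section
/- For real numbers A₁, A₂, A₃, A₄, B₁, B₂, B₃, T′, let X be the 4×4 real matrix whose k-th row (k = 1, 2, 3, 4) is [(A_k − T′)(A_k − B₁)(A_k − B₂)(A_k − B₃), A_k(A_k − B₂)(A_k − B₃), A_k(A_k − B₁)(A_k − B₃), A_k(A_k − B₁)(A_k − B₂)], and let X₀ be the 4×4 real matrix whose k-th row is [(A_k − B₁)(A_k − B₂)(A_k − B₃), (A_k − B₂)(A_k − B₃), (A_k − B₁)(A_k − B₃), (A_k − B₁)(A_k − B₂)]. Then det X = (A₁A₂A₃A₄ − B₁B₂B₃T′)·det X₀. -/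
/-- The determinant with rows `[a ^ 4 + c, a, a ^ 2, a ^ 3]`, where `a` runs over four elements, is a
multiple of the Vandermonde determinant with rows `[a ^ 3, 1, a, a ^ 2]`. -/
theorem det_pow_four_add_const {R : Type*} [CommRing R] (a₁ a₂ a₃ a₄ c : R) :
    !![a₁ ^ 4 + c, a₁, a₁ ^ 2, a₁ ^ 3;
       a₂ ^ 4 + c, a₂, a₂ ^ 2, a₂ ^ 3;
       a₃ ^ 4 + c, a₃, a₃ ^ 2, a₃ ^ 3;
       a₄ ^ 4 + c, a₄, a₄ ^ 2, a₄ ^ 3].det =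
    (a₁ * a₂ * a₃ * a₄ - c) *
    !![a₁ ^ 3, 1, a₁, a₁ ^ 2;
       a₂ ^ 3, 1, a₂, a₂ ^ 2;
       a₃ ^ 3, 1, a₃, a₃ ^ 2;
       a₄ ^ 3, 1, a₄, a₄ ^ 2].det := by
  simp [Matrix.det_succ_row_zero, Fin.sum_univ_succ, Fin.succAbove]
  ring

/-- The determinant of a matrix whose first row is `[1, 0, 0, 0]` does not depend on the remaining
entries of its first column. -/
theorem det_first_row_one_zero {R : Type*} [CommRing R] (u v w : R) (p q r : Fin 3 → R) :
    !![1, 0, 0, 0;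
       u, p 0, p 1, p 2;
       v, q 0, q 1, q 2;
       w, r 0, r 1, r 2].det = (Matrix.of ![p, q, r]).det := by
  rw [Matrix.det_succ_row_zero, Fin.sum_univ_succ]
  simp [Fin.sum_univ_succ, Matrix.det_fin_three, Fin.succAbove]

/-- Determinant identity `det X = (A₁A₂A₃A₄ − B₁B₂B₃T′)·det X₀`. -/
theorem det_X_eq_factor_mul_det_X0
    (A₁ A₂ A₃ A₄ B₁ B₂ B₃ T' : ℝ) :
    (Matrix.of (fun k j : Fin 4 =>
      ![(fun A : ℝ => (A - T') * (A - B₁) * (A - B₂) * (A - B₃)),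
        (fun A : ℝ => A * (A - B₂) * (A - B₃)),
        (fun A : ℝ => A * (A - B₁) * (A - B₃)),
        (fun A : ℝ => A * (A - B₁) * (A - B₂))] j (![A₁, A₂, A₃, A₄] k))).det =
    (A₁ * A₂ * A₃ * A₄ - B₁ * B₂ * B₃ * T') *
    (Matrix.of (fun k j : Fin 4 =>
      ![(fun A : ℝ => (A - B₁) * (A - B₂) * (A - B₃)),
        (fun A : ℝ => (A - B₂) * (A - B₃)),
        (fun A : ℝ => (A - B₁) * (A - B₃)),
        (fun A : ℝ => (A - B₁) * (A - B₂))] j (![A₁, A₂, A₃, A₄] k))).det := by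
  have hX : (Matrix.of (fun k j : Fin 4 =>
      ![(fun A : ℝ => (A - T') * (A - B₁) * (A - B₂) * (A - B₃)),
        (fun A : ℝ => A * (A - B₂) * (A - B₃)),
        (fun A : ℝ => A * (A - B₁) * (A - B₃)),
        (fun A : ℝ => A * (A - B₁) * (A - B₂))] j (![A₁, A₂, A₃, A₄] k))) =
    !![A₁ ^ 4 + B₁ * B₂ * B₃ * T', A₁, A₁ ^ 2, A₁ ^ 3;
       A₂ ^ 4 + B₁ * B₂ * B₃ * T', A₂, A₂ ^ 2, A₂ ^ 3;
       A₃ ^ 4 + B₁ * B₂ * B₃ * T', A₃, A₃ ^ 2, A₃ ^ 3;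
       A₄ ^ 4 + B₁ * B₂ * B₃ * T', A₄, A₄ ^ 2, A₄ ^ 3] *
    !![1, 0, 0, 0;
       -(B₁ * B₂ * B₃ + (B₁ * B₂ + B₁ * B₃ + B₂ * B₃) * T'), B₂ * B₃, B₁ * B₃, B₁ * B₂;
       (B₁ * B₂ + B₁ * B₃ + B₂ * B₃) + (B₁ + B₂ + B₃) * T', -(B₂ + B₃), -(B₁ + B₃), -(B₁ + B₂);
       -(B₁ + B₂ + B₃ + T'), 1, 1, 1] := by
    ext k j
    fin_cases k <;> fin_cases j <;> simp [Matrix.mul_apply, Fin.sum_univ_succ] <;> ring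
  have hX₀ : (Matrix.of (fun k j : Fin 4 =>
      ![(fun A : ℝ => (A - B₁) * (A - B₂) * (A - B₃)),
        (fun A : ℝ => (A - B₂) * (A - B₃)),
        (fun A : ℝ => (A - B₁) * (A - B₃)),
        (fun A : ℝ => (A - B₁) * (A - B₂))] j (![A₁, A₂, A₃, A₄] k))) =
    !![A₁ ^ 3, 1, A₁, A₁ ^ 2;
       A₂ ^ 3, 1, A₂, A₂ ^ 2;
       A₃ ^ 3, 1, A₃, A₃ ^ 2;
       A₄ ^ 3, 1, A₄, A₄ ^ 2] *
    !![1, 0, 0, 0;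
       -(B₁ * B₂ * B₃), B₂ * B₃, B₁ * B₃, B₁ * B₂;
       B₁ * B₂ + B₁ * B₃ + B₂ * B₃, -(B₂ + B₃), -(B₁ + B₃), -(B₁ + B₂);
       -(B₁ + B₂ + B₃), 1, 1, 1] := by
    ext k j
    fin_cases k <;> fin_cases j <;> simp [Matrix.mul_apply, Fin.sum_univ_succ] <;> ring
  have hC := det_first_row_one_zero (-(B₁ * B₂ * B₃ + (B₁ * B₂ + B₁ * B₃ + B₂ * B₃) * T'))
    ((B₁ * B₂ + B₁ * B₃ + B₂ * B₃) + (B₁ + B₂ + B₃) * T') (-(B₁ + B₂ + B₃ + T')) ![B₂ * B₃, B₁ * B₃, B₁ * B₂]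
    ![-(B₂ + B₃), -(B₁ + B₃), -(B₁ + B₂)] ![1, 1, 1]
  have hC₀ := det_first_row_one_zero (-(B₁ * B₂ * B₃)) (B₁ * B₂ + B₁ * B₃ + B₂ * B₃)
    (-(B₁ + B₂ + B₃)) ![B₂ * B₃, B₁ * B₃, B₁ * B₂]
    ![-(B₂ + B₃), -(B₁ + B₃), -(B₁ + B₂)] ![1, 1, 1]
  simp only [Matrix.cons_val] at hC hC₀
  rw [hX, hX₀, Matrix.det_mul, Matrix.det_mul, hC, hC₀, det_pow_four_add_const, mul_assoc]
end

section
/- For real numbers A₁, A₂, A₃, A₄, B₁, B₂, B₃, let X₀ be the 4×4 real matrix whose k-th row (k = 1, 2, 3, 4) is [(A_k − B₁)(A_k − B₂)(A_k − B₃), (A_k − B₂)(A_k − B₃), (A_k − B₁)(A_k − B₃), (A_k − B₁)(A_k − B₂)]. Then there exists a nonzero real constant x₀, independent of the variables, such that for all real A₁, …, A₄, B₁, B₂, B₃, det X₀ = x₀ · ∏_{1 ≤ i < j ≤ 4} (A_i − A_j) · ∏_{1 ≤ i < j ≤ 3} (B_i − B_j). -/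
/-- `det X₀` factors as a nonzero constant times the two Vandermonde-type products. -/
theorem det_X0_eq_const_mul_vandermonde :
    ∃ x₀ : ℝ, x₀ ≠ 0 ∧ ∀ A₁ A₂ A₃ A₄ B₁ B₂ B₃ : ℝ,
      (Matrix.of (fun k j : Fin 4 =>
        ![(fun A : ℝ => (A - B₁) * (A - B₂) * (A - B₃)),
          (fun A : ℝ => (A - B₂) * (A - B₃)),
          (fun A : ℝ => (A - B₁) * (A - B₃)),
          (fun A : ℝ => (A - B₁) * (A - B₂))] j (![A₁, A₂, A₃, A₄] k))).det =
      x₀ * ((A₁ - A₂) * (A₁ - A₃) * (A₁ - A₄) * (A₂ - A₃) * (A₂ - A₄) * (A₃ - A₄)) *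
        ((B₁ - B₂) * (B₁ - B₃) * (B₂ - B₃)) := by
  refine ⟨-1, by norm_num, fun A₁ A₂ A₃ A₄ B₁ B₂ B₃ => ?_⟩
  simp [Matrix.det_succ_row_zero, Fin.sum_univ_succ, Fin.succAbove]
  ring
end

section
/- Let A₁, A₂, A₃, A₄, B₁, B₂, B₃ be positive real numbers with A₁ < B₁ < A₂ < B₂ < A₃ < B₃ < A₄, let T′ be a real number, and suppose there exist real numbers (C′, D₁′, D₂′, D₃′) ≠ (0, 0, 0, 0) such that for each k = 1, 2, 3, 4: C′·(A_k − T′)(A_k − B₁)(A_k − B₂)(A_k − B₃) − D₁′·A_k(A_k − B₂)(A_k − B₃) − D₂′·A_k(A_k − B₁)(A_k − B₃) − D₃′·A_k(A_k − B₁)(A_k − B₂) = 0. Then A₁A₂A₃A₄ = B₁B₂B₃T′. -/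
/-- A cubic with four distinct roots vanishes identically. -/
lemma cubic_eq_zero_of_four_roots {R : Type*} [CommRing R] [IsDomain R] {a b c d : R}
    {r : Fin 4 → R} (hr : Function.Injective r)
    (h : ∀ i, a * r i ^ 3 + b * r i ^ 2 + c * r i + d = 0) (x : R) :
    a * x ^ 3 + b * x ^ 2 + c * x + d = 0 := by
  open Polynomial in
  have hp : C a * X ^ 3 + C b * X ^ 2 + C c * X + C d = 0 :=
    eq_zero_of_natDegree_lt_card_of_eval_eq_zero _ hr (by simpa using h)
      (natDegree_cubic_le.trans_lt (by simp))
  simpa using congrArg (Polynomial.eval x) hp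

/-- A nontrivial solution of the homogeneous linear system (exponential-coordinate form of
the `m = 4` equation-system theorem) forces the product relation `A₁A₂A₃A₄ = B₁B₂B₃T′`. -/
theorem product_relation_of_nontrivial_solution
    (A₁ A₂ A₃ A₄ B₁ B₂ B₃ : ℝ) (T' : ℝ)
    (hA₁ : 0 < A₁) (hA₂ : 0 < A₂) (hA₃ : 0 < A₃) (hA₄ : 0 < A₄)
    (hB₁ : 0 < B₁) (hB₂ : 0 < B₂) (hB₃ : 0 < B₃)
    (h₁ : A₁ < B₁) (h₂ : B₁ < A₂) (h₃ : A₂ < B₂) (h₄ : B₂ < A₃)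
    (h₅ : A₃ < B₃) (h₆ : B₃ < A₄)
    (C' D₁' D₂' D₃' : ℝ)
    (hnontriv : ¬ (C' = 0 ∧ D₁' = 0 ∧ D₂' = 0 ∧ D₃' = 0))
    (hsys : ∀ A ∈ ({A₁, A₂, A₃, A₄} : Set ℝ),
      C' * ((A - T') * (A - B₁) * (A - B₂) * (A - B₃)) -
        D₁' * (A * (A - B₂) * (A - B₃)) -
        D₂' * (A * (A - B₁) * (A - B₃)) -
        D₃' * (A * (A - B₁) * (A - B₂)) = 0) :
    A₁ * A₂ * A₃ * A₄ = B₁ * B₂ * B₃ * T' := by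
  have hr : StrictMono ![A₁, A₂, A₃, A₄] := by
    simp [Fin.strictMono_iff_lt_succ, Fin.forall_fin_succ, h₁.trans h₂, h₃.trans h₄, h₅.trans h₆]
  -- The quartic of the system minus its leading coefficient times ∏ (x - Aₖ) is a cubic.
  have hpoly : ∀ x : ℝ,
      C' * ((x - T') * (x - B₁) * (x - B₂) * (x - B₃)) -
        D₁' * (x * (x - B₂) * (x - B₃)) -
        D₂' * (x * (x - B₁) * (x - B₃)) -
        D₃' * (x * (x - B₁) * (x - B₂)) =
      C' * ((x - A₁) * (x - A₂) * (x - A₃) * (x - A₄)) := by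
    intro x
    have hcubic := cubic_eq_zero_of_four_roots
      (a := C' * (A₁ + A₂ + A₃ + A₄ - T' - B₁ - B₂ - B₃) - D₁' - D₂' - D₃')
      (b := C' * (T' * (B₁ + B₂ + B₃) + B₁ * B₂ + B₁ * B₃ + B₂ * B₃
          - (A₁ * A₂ + A₁ * A₃ + A₁ * A₄ + A₂ * A₃ + A₂ * A₄ + A₃ * A₄))
        + D₁' * (B₂ + B₃) + D₂' * (B₁ + B₃) + D₃' * (B₁ + B₂))
      (c := C' * (A₁ * A₂ * A₃ + A₁ * A₂ * A₄ + A₁ * A₃ * A₄ + A₂ * A₃ * A₄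
          - T' * (B₁ * B₂ + B₁ * B₃ + B₂ * B₃) - B₁ * B₂ * B₃)
        - D₁' * (B₂ * B₃) - D₂' * (B₁ * B₃) - D₃' * (B₁ * B₂))
      (d := C' * (T' * B₁ * B₂ * B₃ - A₁ * A₂ * A₃ * A₄)) hr.injective (fun i => by
        fin_cases i <;> simp only [Fin.zero_eta, Fin.mk_one, Fin.reduceFinMk, Matrix.cons_val]
        · linear_combination hsys A₁ (by simp)
        · linear_combination hsys A₂ (by simp)
        · linear_combination hsys A₃ (by simp)
        · linear_combination hsys A₄ (by simp)) x
    linear_combination hcubic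
  have hC : C' ≠ 0 := by
    rintro rfl
    have h₁₂ : B₁ - B₂ ≠ 0 := by linarith
    have h₁₃ : B₁ - B₃ ≠ 0 := by linarith
    have h₂₃ : B₂ - B₃ ≠ 0 := by linarith
    refine hnontriv ⟨rfl, ?_, ?_, ?_⟩
    · have hne : B₁ * (B₁ - B₂) * (B₁ - B₃) ≠ 0 := by positivity
      exact (mul_eq_zero.mp (by linear_combination -hpoly B₁)).resolve_right hne
    · have hne : B₂ * (B₁ - B₂) * (B₂ - B₃) ≠ 0 := by positivity
      exact (mul_eq_zero.mp (by linear_combination hpoly B₂)).resolve_right hne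
    · have hne : B₃ * (B₁ - B₃) * (B₂ - B₃) ≠ 0 := by positivity
      exact (mul_eq_zero.mp (by linear_combination -hpoly B₃)).resolve_right hne
  exact mul_left_cancel₀ hC (by linear_combination -hpoly 0)
end

section
/- The map z ↦ (π/2)·sinh(z) is a bijection from the strip D_{π/2} = {z ∈ ℂ : |Im z| < π/2} onto the slit plane ℂ \ {iy : y ∈ ℝ, |y| ≥ π/2}. -/
open Real

theorem Complex.re_exp_pos_of_abs_im_lt {z : ℂ} (hz : |z.im| < π / 2) : 0 < (Complex.exp z).re := by
  rw [Complex.exp_re]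
  exact mul_pos (Real.exp_pos _) (Real.cos_pos_of_mem_Ioo (abs_lt.1 hz))

theorem Complex.mapsTo_sinh_strip :
    Set.MapsTo Complex.sinh {z : ℂ | |z.im| < π / 2} ({w : ℂ | w.re = 0 ∧ 1 ≤ |w.im|}ᶜ) := by
  rintro z hz ⟨hre, him⟩
  have hcos : 0 < Real.cos z.im := Real.cos_pos_of_mem_Ioo (abs_lt.1 hz)
  have hsinh : Complex.sinh z = (Real.sinh z.re * Real.cos z.im : ℝ)
      + (Real.cosh z.re * Real.sin z.im : ℝ) * Complex.I := by
    conv_lhs => rw [← Complex.re_add_im z, Complex.sinh_add, Complex.sinh_mul_I,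
      Complex.cosh_mul_I]
    push_cast
    ring
  rw [hsinh, Complex.add_re, Complex.ofReal_re, Complex.re_ofReal_mul, Complex.I_re, mul_zero,
    add_zero] at hre
  rw [hsinh, Complex.add_im, Complex.ofReal_im, Complex.im_ofReal_mul, Complex.I_im, mul_one,
    zero_add] at him
  have hx : z.re = 0 := Real.sinh_eq_zero.1 ((mul_eq_zero.1 hre).resolve_right hcos.ne')
  rw [hx, Real.cosh_zero, one_mul] at him
  have hsq : 1 ≤ Real.sin z.im ^ 2 := (one_le_sq_iff_one_le_abs _).2 him
  nlinarith [Real.sin_sq_add_cos_sq z.im]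

theorem Complex.injOn_sinh_strip : Set.InjOn Complex.sinh {z : ℂ | |z.im| < π / 2} := by
  intro z hz w hw h
  rw [Set.mem_ofPred_eq] at hz hw
  have hz' := abs_lt.1 hz
  have hw' := abs_lt.1 hw
  have hpi := Real.pi_pos
  have hmul : (Complex.exp z - Complex.exp w) * (Complex.exp z + Complex.exp (-w)) = 0 := by
    rw [Complex.sinh, Complex.sinh] at h
    have h₁ : Complex.exp z * Complex.exp (-z) = 1 := by simp [← Complex.exp_add]
    have h₂ : Complex.exp w * Complex.exp (-w) = 1 := by simp [← Complex.exp_add]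
    linear_combination 2 * Complex.exp z * h + h₁ - h₂
  rcases mul_eq_zero.1 hmul with h | h
  · exact Complex.exp_inj_of_neg_pi_lt_of_le_pi (by linarith) (by linarith) (by linarith)
      (by linarith) (sub_eq_zero.1 h)
  · have h₁ := Complex.re_exp_pos_of_abs_im_lt hz
    have h₂ : 0 < (Complex.exp (-w)).re :=
      Complex.re_exp_pos_of_abs_im_lt (by simpa using hw)
    have h₃ := congrArg Complex.re h
    rw [Complex.add_re, Complex.zero_re] at h₃
    linarith

theorem Complex.surjOn_sinh_strip :
    Set.SurjOn Complex.sinh {z : ℂ | |z.im| < π / 2} ({w : ℂ | w.re = 0 ∧ 1 ≤ |w.im|}ᶜ) := by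
  intro w hw
  have key : ∀ u : ℂ, 0 < u.re → u * u - 2 * w * u - 1 = 0 →
      w ∈ Complex.sinh '' {z : ℂ | |z.im| < π / 2} := by
    intro u hu hquad
    have hu0 : u ≠ 0 := by rintro rfl; simp at hu
    refine ⟨Complex.log u, ?_, ?_⟩
    · rw [Set.mem_ofPred_eq, Complex.log_im]
      exact Complex.abs_arg_lt_pi_div_two_iff.2 (Or.inl hu)
    · rw [Complex.sinh, Complex.exp_neg, Complex.exp_log hu0]
      field_simp
      linear_combination hquad
  obtain ⟨s, hs⟩ := IsAlgClosed.exists_pow_nat_eq (w ^ 2 + 1) two_pos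
  set u := w + s with hu
  have hquad : u * u - 2 * w * u - 1 = 0 := by
    rw [hu]
    linear_combination hs
  have hu0 : u ≠ 0 := by
    intro h
    simp [h] at hquad
  rcases lt_trichotomy u.re 0 with hneg | hzero | hpos
  · refine key (-u⁻¹) ?_ ?_
    · rw [Complex.neg_re, Complex.inv_re, ← neg_div]
      exact div_pos (neg_pos.2 hneg) (Complex.normSq_pos.2 hu0)
    · field_simp
      linear_combination -hquad
  · have hre := congrArg Complex.re hquad
    have him := congrArg Complex.im hquad
    simp [hzero] at hre him
    have him0 : u.im ≠ 0 := fun h => hu0 (Complex.ext hzero h)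
    have hwre : w.re = 0 := him.resolve_right him0
    refine absurd ⟨hwre, ?_⟩ hw
    rw [← one_le_sq_iff_one_le_abs]
    have hpos : 0 < u.im ^ 2 := by positivity
    have hw2 : 2 * (w.im * u.im) = u.im ^ 2 + 1 := by linarith
    have hw4 : 4 * (w.im ^ 2 * u.im ^ 2) = (u.im ^ 2 + 1) ^ 2 := by
      rw [← hw2]
      ring
    nlinarith [sq_nonneg (u.im ^ 2 - 1)]
  · exact key u hpos hquad

theorem Complex.bijOn_sinh_strip :
    Set.BijOn Complex.sinh {z : ℂ | |z.im| < π / 2} ({w : ℂ | w.re = 0 ∧ 1 ≤ |w.im|}ᶜ) :=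
  ⟨Complex.mapsTo_sinh_strip, Complex.injOn_sinh_strip, Complex.surjOn_sinh_strip⟩

/-- Scaling by `r > 0` takes the plane slit along `{iy : |y| ≥ 1}` onto the plane slit along
`{iy : |y| ≥ r}`. -/
theorem Complex.bijOn_ofReal_mul_slit {r : ℝ} (hr : 0 < r) :
    Set.BijOn (fun w : ℂ => (r : ℂ) * w) ({w : ℂ | w.re = 0 ∧ 1 ≤ |w.im|}ᶜ)
      ({w : ℂ | w.re = 0 ∧ r ≤ |w.im|}ᶜ) := by
  have hr0 : (r : ℂ) ≠ 0 := Complex.ofReal_ne_zero.2 hr.ne'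
  have hmem : ∀ w : ℂ, (r : ℂ) * w ∈ ({w : ℂ | w.re = 0 ∧ r ≤ |w.im|}ᶜ : Set ℂ) ↔
      w ∈ ({w : ℂ | w.re = 0 ∧ 1 ≤ |w.im|}ᶜ : Set ℂ) := by
    intro w
    simp [abs_mul, abs_of_pos hr, hr.ne', hr]
  refine ⟨fun w hw => (hmem w).2 hw, (mul_right_injective₀ hr0).injOn, fun w hw => ?_⟩
  have hw' : (r : ℂ) * ((r : ℂ)⁻¹ * w) = w := mul_inv_cancel_left₀ hr0 w
  exact ⟨(r : ℂ)⁻¹ * w, (hmem _).1 (hw'.symm ▸ hw), hw'⟩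

/-- The map `z ↦ (π/2)·sinh z` is a bijection from the strip `D_{π/2}` onto the plane with
the two vertical slits `{iy : |y| ≥ π/2}` removed. -/
theorem DE_kernel_bijOn_strip :
    Set.BijOn (fun z : ℂ => ((π / 2 : ℝ) : ℂ) * Complex.sinh z)
      {z : ℂ | |z.im| < π / 2}
      ({w : ℂ | w.re = 0 ∧ π / 2 ≤ |w.im|}ᶜ) :=
  (Complex.bijOn_ofReal_mul_slit Real.pi_div_two_pos).comp Complex.bijOn_sinh_strip
end

section
/- Let M ≥ 1, let τ₁, …, τ_M be real numbers, let α₁, …, α_M be real numbers, and let θ₊, θ₋ ∈ [0, 1]. Set θ̄ = (θ₊+θ₋)/2, Δθ = (θ₊−θ₋)/2, S = Σ_{j=1}^{M} (α_j − 1)·τ_j, and assume Σ_{j=1}^{M} (α_j − 1) = θ̄. Then there exists a constant K such that for all real t, |e^{Δθ·t}·(∏_{j=1}^{M−1} cosh(t−τ_j)^{α_j−1})·cosh(t−τ_M)^{α_M−2}·sinh(t−τ_M) − (e^{Δθ·t}/2^{θ̄−1})·sinh(θ̄·t − S)| ≤ K. -/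
open Real

/-- Real powers of `cosh u` with the leading exponential as `u → ∞` factored out. -/
lemma cosh_rpow_eq_exp_mul (u a : ℝ) :
    cosh u ^ a = exp (a * (u - log 2)) * (1 + exp (-2 * u)) ^ a := by
  have h : cosh u = exp (u - log 2) * (1 + exp (-2 * u)) := by
    rw [cosh_eq, exp_sub, exp_log two_pos, div_mul_eq_mul_div, mul_add, ← exp_add]
    ring_nf
  rw [h, mul_rpow (exp_pos _).le (by positivity), ← exp_mul, mul_comm a]

/-- `sinh u` with the leading exponential as `u → ∞` factored out. -/
lemma sinh_eq_exp_mul (u : ℝ) :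
    sinh u = exp (u - log 2) * (1 - exp (-2 * u)) := by
  rw [sinh_eq, exp_sub, exp_log two_pos, div_mul_eq_mul_div, mul_sub, ← exp_add]
  ring_nf

/-- A product of real powers of `1 + c x` with `c ≥ 0`, times `1 - d x`, differs from its value `1`
at `x = 0` by at most a multiple of `x` on the unit interval. -/
lemma exists_abs_prod_one_add_rpow_sub_one_le {ι : Type*} (s : Finset ι) (c a : ι → ℝ)
    (hc : ∀ j, 0 ≤ c j) (d b : ℝ) (hd : 0 ≤ d) :
    ∃ C : ℝ, 0 ≤ C ∧ ∀ x ∈ Set.Icc (0 : ℝ) 1,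
      |(∏ j ∈ s, (1 + c j * x) ^ a j) * (1 + d * x) ^ b * (1 - d * x) - 1| ≤ C * x := by
  have hfactor (e p : ℝ) (he : 0 ≤ e) :
      ContDiffOn ℝ 1 (fun x : ℝ => (1 + e * x) ^ p) (Set.Icc 0 1) := by
    refine ContDiffOn.rpow_const_of_ne (by fun_prop) fun x hx => ?_
    have := mul_nonneg he hx.1
    positivity
  have hG : ContDiffOn ℝ 1 (fun x : ℝ =>
      (∏ j ∈ s, (1 + c j * x) ^ a j) * (1 + d * x) ^ b * (1 - d * x)) (Set.Icc 0 1) :=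
    ((contDiffOn_prod fun j _ => hfactor (c j) (a j) (hc j)).mul (hfactor d b hd)).mul
      (by fun_prop)
  obtain ⟨C, hC⟩ := hG.exists_lipschitzOnWith one_ne_zero (convex_Icc 0 1) isCompact_Icc
  refine ⟨C, C.2, fun x hx => ?_⟩
  simpa [Real.dist_eq, abs_of_nonneg hx.1] using
    hC.dist_le_mul x hx 0 (Set.left_mem_Icc.2 zero_le_one)

/-- The one-sided version of the boundary-term asymptotic, for `t ≥ 0`. -/
lemma exists_boundary_term_bound_of_nonneg
    (n : ℕ) (τ α : Fin (n + 1) → ℝ)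
    (θp θm : ℝ) (hθp : θp ≤ 1) (hθm : 0 ≤ θm)
    (hsum : ∑ j, (α j - 1) = (θp + θm) / 2) :
    ∃ K : ℝ, ∀ t : ℝ, 0 ≤ t →
      |exp ((θp - θm) / 2 * t) *
          (∏ j : Fin n, cosh (t - τ j.castSucc) ^ (α j.castSucc - 1)) *
          cosh (t - τ (Fin.last n)) ^ (α (Fin.last n) - 2) *
          sinh (t - τ (Fin.last n)) -
        exp ((θp - θm) / 2 * t) / (2 : ℝ) ^ ((θp + θm) / 2 - 1) *
          sinh ((θp + θm) / 2 * t - ∑ j, (α j - 1) * τ j)| ≤ K := by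
  obtain ⟨C, hC0, hC⟩ := exists_abs_prod_one_add_rpow_sub_one_le Finset.univ
    (fun j : Fin n => exp (2 * τ j.castSucc)) (fun j => α j.castSucc - 1)
    (fun j => (exp_pos _).le) (exp (2 * τ (Fin.last n))) (α (Fin.last n) - 2) (exp_pos _).le
  set S := ∑ j, (α j - 1) * τ j with hS
  set L := (θp + θm) / 2 * log 2 with hL
  refine ⟨C * exp (-S - L) + exp (S - L), fun t ht => ?_⟩
  have hx : exp (-2 * t) ∈ Set.Icc (0 : ℝ) 1 :=
    ⟨(exp_pos _).le, exp_le_one_iff.2 (by linarith)⟩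
  have hGx := hC _ hx
  set G := (∏ j : Fin n, (1 + exp (2 * τ j.castSucc) * exp (-2 * t)) ^ (α j.castSucc - 1)) *
    (1 + exp (2 * τ (Fin.last n)) * exp (-2 * t)) ^ (α (Fin.last n) - 2) *
    (1 - exp (2 * τ (Fin.last n)) * exp (-2 * t)) with hG
  have hshift (c : ℝ) : exp (-2 * (t - c)) = exp (2 * c) * exp (-2 * t) := by
    rw [← exp_add]
    ring_nf
  have hexponent : (θp - θm) / 2 * t +
      ∑ j : Fin n, (α j.castSucc - 1) * (t - τ j.castSucc - log 2) +
      (α (Fin.last n) - 2) * (t - τ (Fin.last n) - log 2) + (t - τ (Fin.last n) - log 2) =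
      θp * t - S - L := by
    have hall : ∑ j, (α j - 1) * (t - τ j - log 2) = (θp + θm) / 2 * (t - log 2) - S := by
      rw [← hsum, hS, Finset.sum_mul, ← Finset.sum_sub_distrib]
      exact Finset.sum_congr rfl fun j _ => by ring
    rw [Fin.sum_univ_castSucc] at hall
    linear_combination hall
  have hfirst : exp ((θp - θm) / 2 * t) *
      (∏ j : Fin n, cosh (t - τ j.castSucc) ^ (α j.castSucc - 1)) *
      cosh (t - τ (Fin.last n)) ^ (α (Fin.last n) - 2) *
      sinh (t - τ (Fin.last n)) = exp (θp * t - S - L) * G := by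
    simp only [cosh_rpow_eq_exp_mul, sinh_eq_exp_mul, Finset.prod_mul_distrib, ← exp_sum, hshift]
    rw [← hexponent, exp_add, exp_add, exp_add, hG]
    ring
  have hsecond : exp ((θp - θm) / 2 * t) / (2 : ℝ) ^ ((θp + θm) / 2 - 1) *
      sinh ((θp + θm) / 2 * t - S) = exp (θp * t - S - L) - exp (-θm * t + (S - L)) := by
    rw [sinh_eq_exp_mul, rpow_def_of_pos two_pos, ← exp_sub, ← mul_assoc, ← exp_add, mul_sub,
      ← exp_add, mul_one]
    congr 2 <;> rw [hL] <;> ring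
  rw [hfirst, hsecond]
  calc |exp (θp * t - S - L) * G - (exp (θp * t - S - L) - exp (-θm * t + (S - L)))|
      = |exp (θp * t - S - L) * (G - 1) + exp (-θm * t + (S - L))| := by ring_nf
    _ ≤ exp (θp * t - S - L) * |G - 1| + exp (-θm * t + (S - L)) := by
      refine (abs_add_le _ _).trans_eq ?_
      rw [abs_mul, abs_exp, abs_exp]
    _ ≤ exp (θp * t - S - L) * (C * exp (-2 * t)) + exp (-θm * t + (S - L)) := by gcongr
    _ = C * exp ((θp - 2) * t + (-S - L)) + exp (-θm * t + (S - L)) := by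
      rw [mul_left_comm, ← exp_add]
      ring_nf
    _ ≤ C * exp (-S - L) + exp (S - L) := by
      gcongr
      · nlinarith
      · nlinarith


/-- Boundary-term asymptotic (with `sinh` factor) used in the proof of the asymptotic
expansion of the Schwarz–Christoffel integrand's antiderivative. Here `M = n + 1 ≥ 1`. -/
theorem boundary_term_asymptotic_sinh
    (n : ℕ) (τ α : Fin (n + 1) → ℝ)
    (θp θm : ℝ) (hθp : θp ∈ Set.Icc (0 : ℝ) 1) (hθm : θm ∈ Set.Icc (0 : ℝ) 1)
    (hsum : ∑ j, (α j - 1) = (θp + θm) / 2) :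
    ∃ K : ℝ, ∀ t : ℝ,
      |Real.exp ((θp - θm) / 2 * t) *
          (∏ j : Fin n, Real.cosh (t - τ j.castSucc) ^ (α j.castSucc - 1)) *
          Real.cosh (t - τ (Fin.last n)) ^ (α (Fin.last n) - 2) *
          Real.sinh (t - τ (Fin.last n)) -
        Real.exp ((θp - θm) / 2 * t) / (2 : ℝ) ^ ((θp + θm) / 2 - 1) *
          Real.sinh ((θp + θm) / 2 * t - ∑ j, (α j - 1) * τ j)| ≤ K := by
  obtain ⟨K₁, hK₁⟩ := exists_boundary_term_bound_of_nonneg n τ α θp θm hθp.2 hθm.1 hsum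
  obtain ⟨K₂, hK₂⟩ := exists_boundary_term_bound_of_nonneg n (fun j => -τ j) α θm θp hθm.2 hθp.1
    (by rw [hsum, add_comm])
  refine ⟨max K₁ K₂, fun t => ?_⟩
  rcases le_total 0 t with ht | ht
  · exact (hK₁ t ht).trans (le_max_left _ _)
  · refine le_trans (le_of_eq ?_) ((hK₂ (-t) (neg_nonneg.2 ht)).trans (le_max_right _ _))
    have hexp : (θm - θp) / 2 * -t = (θp - θm) / 2 * t := by ring
    have hneg (c : ℝ) : -t - -c = -(t - c) := by ring
    have hsinh : (θm + θp) / 2 * -t - ∑ j, (α j - 1) * -τ j =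
        -((θp + θm) / 2 * t - ∑ j, (α j - 1) * τ j) := by
      simp only [mul_neg, Finset.sum_neg_distrib]
      ring
    rw [hsinh, hexp, add_comm θm θp]
    simp only [hneg, cosh_neg, sinh_neg]
    rw [← abs_neg]
    congr 1
    ring
end

section
/- Let M ≥ 1, let τ₁, …, τ_M be real numbers, let α₁, …, α_M be real numbers, and let θ₊, θ₋ ∈ [0, 1]. Set θ̄ = (θ₊+θ₋)/2, Δθ = (θ₊−θ₋)/2, S = Σ_{j=1}^{M} (α_j − 1)·τ_j, and assume Σ_{j=1}^{M} (α_j − 1) = θ̄. Then there exists a constant K such that for all real t, |e^{Δθ·t}·(∏_{j=1}^{M−1} cosh(t−τ_j)^{α_j−1})·cosh(t−τ_M)^{α_M−3}·sinh(t−τ_M)² − (e^{Δθ·t}/2^{θ̄−1})·cosh(θ̄·t − S)| ≤ K. -/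
open Real

/-- Factoring the leading exponential out of a real power of `cosh (t - τ)`. -/
lemma cosh_sub_rpow_eq (t τ a : ℝ) :
    cosh (t - τ) ^ a =
      exp (a * t - a * τ) * 2 ^ (-a) * (1 + exp (-2 * t) * exp (2 * τ)) ^ a := by
  have hfactor : cosh (t - τ) =
      exp (t - τ) * 2⁻¹ * (1 + exp (-2 * t) * exp (2 * τ)) := by
    have hexp : exp (-(t - τ)) = exp (t - τ) * (exp (-2 * t) * exp (2 * τ)) := by
      rw [← exp_add, ← exp_add]
      ring_nf
    rw [cosh_eq, hexp]
    ring
  rw [hfactor, mul_rpow (by positivity) (by positivity),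
    mul_rpow (by positivity) (by positivity), ← exp_mul, inv_rpow (by norm_num),
    rpow_neg (by norm_num)]
  ring_nf

lemma tanh_sub_eq (t τ : ℝ) :
    tanh (t - τ) =
      (1 - exp (-2 * t) * exp (2 * τ)) / (1 + exp (-2 * t) * exp (2 * τ)) := by
  have hexp : exp (-(t - τ)) = exp (t - τ) * (exp (-2 * t) * exp (2 * τ)) := by
    rw [← exp_add, ← exp_add]
    ring_nf
  have hpos := exp_pos (t - τ)
  have hden : 0 < 1 + exp (-2 * t) * exp (2 * τ) := by positivity
  rw [tanh_eq_sinh_div_cosh, sinh_eq, cosh_eq, hexp]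
  field_simp

/-- The correction factor, as a function of `x = exp (-2 * t)`, is `1 + O(x)` on `[0, 1]`. -/
lemma exists_abs_prod_rpow_mul_sq_sub_one_le {ι : Type*} [Fintype ι] (c a : ι → ℝ)
    (hc : ∀ j, 0 < c j) (i : ι) :
    ∃ C : ℝ, ∀ x ∈ Set.Icc (0 : ℝ) 1,
      |(∏ j, (1 + x * c j) ^ a j) * ((1 - x * c i) / (1 + x * c i)) ^ 2 - 1| ≤ C * x := by
  set F : ℝ → ℝ := fun x =>
    (∏ j, (1 + x * c j) ^ a j) * ((1 - x * c i) / (1 + x * c i)) ^ 2 with hF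
  have hne : ∀ x ∈ Set.Icc (0 : ℝ) 1, ∀ j, 1 + x * c j ≠ 0 := fun x hx j => by
    have := mul_nonneg hx.1 (hc j).le
    positivity
  have hsmooth : ContDiffOn ℝ 1 F (Set.Icc 0 1) := by
    refine ContDiffOn.mul (contDiffOn_prod fun j _ => ?_) (ContDiffOn.pow ?_ 2)
    · exact ContDiffOn.rpow_const_of_ne (by fun_prop) fun x hx => hne x hx j
    · exact ContDiffOn.div (by fun_prop) (by fun_prop) fun x hx => hne x hx i
  obtain ⟨C, hC⟩ := hsmooth.exists_lipschitzOnWith one_ne_zero (convex_Icc 0 1) isCompact_Icc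
  refine ⟨C, fun x hx => ?_⟩
  have hlip := hC.dist_le_mul x hx 0 (Set.left_mem_Icc.2 zero_le_one)
  have hF0 : F 0 = 1 := by simp [hF]
  rwa [hF0, Real.dist_eq, Real.dist_eq, sub_zero, abs_of_nonneg hx.1] at hlip

/-- The integrand's boundary term as leading exponential times correction factor. -/
lemma prod_cosh_rpow_mul_sinh_sq_eq (n : ℕ) (τ α : Fin (n + 1) → ℝ) (θ t : ℝ)
    (hsum : ∑ j, (α j - 1) = θ) :
    (∏ j : Fin n, cosh (t - τ j.castSucc) ^ (α j.castSucc - 1)) *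
        cosh (t - τ (Fin.last n)) ^ (α (Fin.last n) - 3) * sinh (t - τ (Fin.last n)) ^ 2 =
      exp (θ * t - ∑ j, (α j - 1) * τ j) * 2 ^ (-θ) *
        ((∏ j, (1 + exp (-2 * t) * exp (2 * τ j)) ^ (α j - 1)) *
          ((1 - exp (-2 * t) * exp (2 * τ (Fin.last n))) /
            (1 + exp (-2 * t) * exp (2 * τ (Fin.last n)))) ^ 2) := by
  have hcosh := cosh_pos (t - τ (Fin.last n))
  have hlast : cosh (t - τ (Fin.last n)) ^ (α (Fin.last n) - 3) *
      sinh (t - τ (Fin.last n)) ^ 2 =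
      cosh (t - τ (Fin.last n)) ^ (α (Fin.last n) - 1) * tanh (t - τ (Fin.last n)) ^ 2 := by
    rw [show α (Fin.last n) - 3 = α (Fin.last n) - 1 - (2 : ℕ) by push_cast; ring,
      rpow_sub_natCast hcosh.ne', tanh_eq_sinh_div_cosh]
    field_simp
  have hprod : ∏ j, cosh (t - τ j) ^ (α j - 1) =
      exp (θ * t - ∑ j, (α j - 1) * τ j) * 2 ^ (-θ) *
        ∏ j, (1 + exp (-2 * t) * exp (2 * τ j)) ^ (α j - 1) := by
    simp_rw [cosh_sub_rpow_eq t, Finset.prod_mul_distrib]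
    rw [← exp_sum, ← rpow_sum_of_pos two_pos, Finset.sum_sub_distrib, ← Finset.sum_mul,
      Finset.sum_neg_distrib, hsum]
  rw [mul_assoc, hlast, ← mul_assoc,
    ← Fin.prod_univ_castSucc (fun j => cosh (t - τ j) ^ (α j - 1)), hprod, tanh_sub_eq]
  ring

lemma boundary_term_bounded_of_nonneg
    (n : ℕ) (τ α : Fin (n + 1) → ℝ) (θp θm : ℝ) (hθp : θp ≤ 2) (hθm : 0 ≤ θm)
    (hsum : ∑ j, (α j - 1) = (θp + θm) / 2) :
    ∃ K : ℝ, ∀ t : ℝ, 0 ≤ t →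
      |exp ((θp - θm) / 2 * t) *
          (∏ j : Fin n, cosh (t - τ j.castSucc) ^ (α j.castSucc - 1)) *
          cosh (t - τ (Fin.last n)) ^ (α (Fin.last n) - 3) *
          sinh (t - τ (Fin.last n)) ^ 2 -
        exp ((θp - θm) / 2 * t) / (2 : ℝ) ^ ((θp + θm) / 2 - 1) *
          cosh ((θp + θm) / 2 * t - ∑ j, (α j - 1) * τ j)| ≤ K := by
  obtain ⟨C, hC⟩ := exists_abs_prod_rpow_mul_sq_sub_one_le (fun j => exp (2 * τ j))
    (fun j => α j - 1) (fun j => exp_pos _) (Fin.last n)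
  set S := ∑ j, (α j - 1) * τ j with hS
  set θ := (θp + θm) / 2 with hθ
  refine ⟨2 ^ (-θ) * (exp (-S) * C + exp S), fun t ht => ?_⟩
  have hx : exp (-2 * t) ∈ Set.Icc (0 : ℝ) 1 :=
    ⟨(exp_pos _).le, exp_le_one_iff.2 (by linarith)⟩
  have hCx := hC _ hx
  have hprod := prod_cosh_rpow_mul_sinh_sq_eq n τ α θ t hsum
  rw [← hS] at hprod
  rw [mul_assoc, mul_assoc, ← mul_assoc (∏ j : Fin n, _), hprod]
  generalize (∏ j, (1 + exp (-2 * t) * exp (2 * τ j)) ^ (α j - 1)) *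
    ((1 - exp (-2 * t) * exp (2 * τ (Fin.last n))) /
      (1 + exp (-2 * t) * exp (2 * τ (Fin.last n)))) ^ 2 = G at hCx ⊢
  have hC0 : 0 ≤ C := by
    by_contra! hneg
    exact absurd ((abs_nonneg _).trans hCx) (mul_neg_of_neg_of_pos hneg (exp_pos _)).not_ge
  have hplus : exp ((θp - θm) / 2 * t) * exp (θ * t - S) = exp (-S) * exp (θp * t) := by
    rw [← exp_add, ← exp_add, hθ]
    ring_nf
  have hminus : exp ((θp - θm) / 2 * t) * exp (-(θ * t - S)) = exp S * exp (-(θm * t)) := by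
    rw [← exp_add, ← exp_add, hθ]
    ring_nf
  have htwo : (2 : ℝ) ^ (θ - 1) = ((2 : ℝ) ^ (-θ))⁻¹ / 2 := by
    rw [rpow_sub_one two_ne_zero, rpow_neg zero_le_two, inv_inv]
  have hdiff : exp ((θp - θm) / 2 * t) * (exp (θ * t - S) * 2 ^ (-θ) * G) -
      exp ((θp - θm) / 2 * t) / (2 : ℝ) ^ (θ - 1) * cosh (θ * t - S) =
      2 ^ (-θ) * (exp (-S) * (exp (θp * t) * (G - 1)) - exp S * exp (-(θm * t))) := by
    rw [htwo, cosh_eq, div_eq_mul_inv (exp _), inv_div, div_inv_eq_mul]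
    linear_combination 2 ^ (-θ) * ((G - 1) * hplus - hminus)
  have hlead : |exp (θp * t) * (G - 1)| ≤ C := by
    rw [abs_mul, abs_of_pos (exp_pos _)]
    calc exp (θp * t) * |G - 1| ≤ exp (θp * t) * (C * exp (-2 * t)) := by gcongr
      _ = C * exp ((θp - 2) * t) := by
        rw [mul_left_comm, ← exp_add]
        ring_nf
      _ ≤ C * 1 := by
        gcongr
        exact exp_le_one_iff.2 (mul_nonpos_of_nonpos_of_nonneg (by linarith) ht)
      _ = C := mul_one C
  have hsub : exp (-(θm * t)) ≤ 1 := exp_le_one_iff.2 (by nlinarith)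
  rw [hdiff, abs_mul, abs_of_pos (by positivity : (0 : ℝ) < 2 ^ (-θ))]
  gcongr
  refine (abs_sub _ _).trans (add_le_add ?_ ?_)
  · rw [abs_mul, abs_of_pos (exp_pos _)]
    gcongr
  · rw [abs_of_pos (by positivity)]
    exact mul_le_of_le_one_right (exp_pos _).le hsub

/-- Boundary-term asymptotic (with `sinh²` factor) used in the proof of the asymptotic
expansion of the Schwarz–Christoffel integrand's antiderivative. Here `M = n + 1 ≥ 1`. -/
theorem boundary_term_asymptotic_sinh_sq
    (n : ℕ) (τ α : Fin (n + 1) → ℝ)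
    (θp θm : ℝ) (hθp : θp ∈ Set.Icc (0 : ℝ) 1) (hθm : θm ∈ Set.Icc (0 : ℝ) 1)
    (hsum : ∑ j, (α j - 1) = (θp + θm) / 2) :
    ∃ K : ℝ, ∀ t : ℝ,
      |Real.exp ((θp - θm) / 2 * t) *
          (∏ j : Fin n, Real.cosh (t - τ j.castSucc) ^ (α j.castSucc - 1)) *
          Real.cosh (t - τ (Fin.last n)) ^ (α (Fin.last n) - 3) *
          Real.sinh (t - τ (Fin.last n)) ^ 2 -
        Real.exp ((θp - θm) / 2 * t) / (2 : ℝ) ^ ((θp + θm) / 2 - 1) *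
          Real.cosh ((θp + θm) / 2 * t - ∑ j, (α j - 1) * τ j)| ≤ K := by
  obtain ⟨K₁, hK₁⟩ := boundary_term_bounded_of_nonneg n τ α θp θm
    (by linarith [hθp.2]) hθm.1 hsum
  obtain ⟨K₂, hK₂⟩ := boundary_term_bounded_of_nonneg n (fun j => -τ j) α θm θp
    (by linarith [hθm.2]) hθp.1 (by rw [hsum, add_comm])
  refine ⟨max K₁ K₂, fun t => ?_⟩
  rcases le_total 0 t with ht | ht
  · exact (hK₁ t ht).trans (le_max_left _ _)
  · refine le_trans (le_of_eq ?_) ((hK₂ (-t) (neg_nonneg.2 ht)).trans (le_max_right _ _))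
    have hcosh : ∀ s, cosh (-t - -s) = cosh (t - s) := fun s => by
      rw [← cosh_neg (t - s)]
      ring_nf
    have hsinh : ∀ s, sinh (-t - -s) ^ 2 = sinh (t - s) ^ 2 := fun s => by
      rw [← neg_sq (sinh (t - s)), ← sinh_neg]
      ring_nf
    have hexp : (θm - θp) / 2 * -t = (θp - θm) / 2 * t := by ring
    have hmain : cosh ((θp + θm) / 2 * -t - ∑ j, (α j - 1) * -τ j) =
        cosh ((θp + θm) / 2 * t - ∑ j, (α j - 1) * τ j) := by
      simp_rw [mul_neg, Finset.sum_neg_distrib]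
      rw [← cosh_neg]
      ring_nf
    simp only [hcosh, hsinh, hexp, add_comm θm θp, hmain]
end
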